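/- Let α be an odd superfield and u an even superfield, let λ₀, λ ∈ ℝ, let θ₀ be an even invertible superfield with Lθ₀ = λ₀θ₀, and let ψ be any superfield with Lψ = λψ. Then ψ̂ := Dψ + δ₀ψ satisfies L̂ψ̂ = λψ̂. -/

import Mathlib

noncomputable section
open scoped BigOperators

/-- The exterior algebra `Λ` of `ℝ^N`. -/
abbrev SuperAlg (N : ℕ) : Type := ExteriorAlgebra ℝ (Fin N → ℝ)

/-- The even part `Λ₀` of the exterior algebra. -/
def LambdaEven (N : ℕ) : Submodule ℝ (SuperAlg N) :=
  CliffordAlgebra.evenOdd (0 : QuadraticForm ℝ (Fin N → ℝ)) 0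

/-- The odd part `Λ₁` of the exterior algebra. -/
def LambdaOdd (N : ℕ) : Submodule ℝ (SuperAlg N) :=
  CliffordAlgebra.evenOdd (0 : QuadraticForm ℝ (Fin N → ℝ)) 1

/-- A superfield: a pair `(f₀, f₁)` of maps `ℝ² → Λ`, encoding
`f(x,t,ϑ) = f₀(x,t) + ϑ f₁(x,t)`. -/
@[ext] structure SF (N : ℕ) where
  c0 : ℝ → ℝ → SuperAlg N
  c1 : ℝ → ℝ → SuperAlg N

namespace SF
variable {N : ℕ}

instance : Zero (SF N) := ⟨⟨0, 0⟩⟩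
instance : Add (SF N) := ⟨fun f g => ⟨f.c0 + g.c0, f.c1 + g.c1⟩⟩
instance : Neg (SF N) := ⟨fun f => ⟨-f.c0, -f.c1⟩⟩
instance : Sub (SF N) := ⟨fun f g => ⟨f.c0 - g.c0, f.c1 - g.c1⟩⟩
instance : SMul ℕ (SF N) := ⟨fun n f => ⟨n • f.c0, n • f.c1⟩⟩
instance : SMul ℤ (SF N) := ⟨fun n f => ⟨n • f.c0, n • f.c1⟩⟩
instance : SMul ℝ (SF N) := ⟨fun r f => ⟨r • f.c0, r • f.c1⟩⟩

instance : AddCommGroup (SF N) :=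
  Function.Injective.addCommGroup
    (M₂ := (ℝ → ℝ → SuperAlg N) × (ℝ → ℝ → SuperAlg N))
    (fun f => (f.c0, f.c1))
    (fun a b h => by cases a; cases b; simpa using h)
    rfl (fun _ _ => rfl) (fun _ => rfl) (fun _ _ => rfl) (fun _ _ => rfl) (fun _ _ => rfl)

instance : One (SF N) := ⟨⟨fun _ _ => 1, fun _ _ => 0⟩⟩

/-- The product of superfields: `(fg)₀ = f₀g₀`,
`(fg)₁ = f₁g₀ + σ(f₀)g₁` where `σ` is the grade involution of `Λ`
(this is the bilinear extension of the parity-sign formula for homogeneous factors). -/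
instance : Mul (SF N) := ⟨fun f g =>
  ⟨fun x t => f.c0 x t * g.c0 x t,
   fun x t => f.c1 x t * g.c0 x t + CliffordAlgebra.involute (f.c0 x t) * g.c1 x t⟩⟩

/-- An even superfield. -/
def IsEven (f : SF N) : Prop :=
  (∀ x t, f.c0 x t ∈ LambdaEven N) ∧ (∀ x t, f.c1 x t ∈ LambdaOdd N)

/-- An odd superfield. -/
def IsOdd (f : SF N) : Prop :=
  (∀ x t, f.c0 x t ∈ LambdaOdd N) ∧ (∀ x t, f.c1 x t ∈ LambdaEven N)

/-- A superfield is invertible when `f₀(x,t)` is invertible in `Λ` for all `(x,t)`. -/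
def Invertible (f : SF N) : Prop := ∀ x t, IsUnit (f.c0 x t)

/-- The multiplicative inverse of a superfield (junk unless `f` is invertible). -/
def sinv (f : SF N) : SF N :=
  ⟨fun x t => Ring.inverse (f.c0 x t),
   fun x t => -(Ring.inverse (CliffordAlgebra.involute (f.c0 x t)) * f.c1 x t *
      Ring.inverse (f.c0 x t))⟩

end SF

/-- Derivative of a `Λ`-valued function of one real variable, characterized through all
linear functionals (junk value `0` when not differentiable). -/
def derLam {N : ℕ} (g : ℝ → SuperAlg N) (x : ℝ) : SuperAlg N := by
  classical
  exact if h : ∃ d : SuperAlg N, ∀ l : SuperAlg N →ₗ[ℝ] ℝ,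
      HasDerivAt (fun y => l (g y)) (l d) x
    then h.choose else 0

/-- Smoothness of a `Λ`-valued function on `ℝ²`. -/
def SmoothLam {N : ℕ} (g : ℝ → ℝ → SuperAlg N) : Prop :=
  ∀ l : SuperAlg N →ₗ[ℝ] ℝ, ContDiff ℝ (⊤ : ℕ∞) (fun p : ℝ × ℝ => l (g p.1 p.2))

namespace SF
variable {N : ℕ}

/-- A superfield is smooth when both components are. -/
def Smooth (f : SF N) : Prop := SmoothLam f.c0 ∧ SmoothLam f.c1

/-- `∂f`, the `x`-derivative. -/
def dx (f : SF N) : SF N :=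
  ⟨fun x t => derLam (fun y => f.c0 y t) x, fun x t => derLam (fun y => f.c1 y t) x⟩

/-- `∂ₜf`, the `t`-derivative. -/
def dt (f : SF N) : SF N :=
  ⟨fun x t => derLam (fun s => f.c0 x s) t, fun x t => derLam (fun s => f.c1 x s) t⟩

/-- The odd superderivative `D`, with `Df = (f₁, ∂ₓf₀)`, so `D ∘ D = ∂`. -/
def Dsd (f : SF N) : SF N := ⟨f.c1, fun x t => derLam (fun y => f.c0 y t) x⟩

end SF

/-- `D^n`. -/
def Dpow {N : ℕ} : ℕ → SF N → SF N
  | 0, f => f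
  | m + 1, f => (Dpow m f).Dsd

/-- `∂^n`. -/
def Xpow {N : ℕ} : ℕ → SF N → SF N
  | 0, f => f
  | m + 1, f => (Xpow m f).dx

/-- `f` has the parity `(−1)^m`. -/
def parityAt {N : ℕ} (f : SF N) (m : ℕ) : Prop :=
  if m % 2 = 0 then f.IsEven else f.IsOdd

/-- The Manin–Radul supersymmetric KdV system. -/
def MRSKdV {N : ℕ} (α u : SF N) : Prop :=
  α.dt = (1/4 : ℝ) • (α.dx.dx + (3:ℝ) • (α * α.Dsd) + (6:ℝ) • (α * u)).dx ∧
  u.dt = (1/4 : ℝ) • (u.dx.dx + (3:ℝ) • (u * u) + (3:ℝ) • (α * u.Dsd)).dx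

/-- The Lax operator `L = ∂² + αD + u`. -/
def Lop {N : ℕ} (α u ψ : SF N) : SF N := ψ.dx.dx + α * ψ.Dsd + u * ψ

/-- The operator `M = (1/2)α∂D + λ∂ + (1/2)u∂ − (1/4)(∂α)D − (1/4)(∂u)`. -/
def Mop {N : ℕ} (α u : SF N) (lam : ℝ) (ψ : SF N) : SF N :=
  (1/2 : ℝ) • (α * ψ.Dsd.dx) + lam • ψ.dx + (1/2 : ℝ) • (u * ψ.dx)
    - (1/4 : ℝ) • (α.dx * ψ.Dsd) - (1/4 : ℝ) • (u.dx * ψ)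

/-- The linear system `Lψ = λψ`, `∂ₜψ = Mψ` associated with `(α,u)` at `λ`. -/
def LinSys {N : ℕ} (α u : SF N) (lam : ℝ) (ψ : SF N) : Prop :=
  Lop α u ψ = lam • ψ ∧ ψ.dt = Mop α u lam ψ

/-- `δ₀ = −(Dθ₀)θ₀⁻¹`. -/
def delta0 {N : ℕ} (θ : SF N) : SF N := -(θ.Dsd * θ.sinv)

/-- The Darboux-transformed `α̂ = −α − 2∂δ₀`. -/
def hatAlpha {N : ℕ} (α θ : SF N) : SF N := -α - (2:ℝ) • (delta0 θ).dx

/-- The Darboux-transformed `û = u + Dα + 2δ₀(α + ∂δ₀)`. -/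
def hatU {N : ℕ} (α u θ : SF N) : SF N :=
  u + α.Dsd + (2:ℝ) • (delta0 θ * (α + (delta0 θ).dx))

/-- `darbIter θ m j = θ_j[m]`, the `j`-th seed after `m` Darboux steps. -/
def darbIter {N : ℕ} (θ : ℕ → SF N) : ℕ → ℕ → SF N
  | 0, j => θ j
  | m + 1, j => (darbIter θ m j).Dsd + delta0 (darbIter θ m m) * darbIter θ m j

/-- `Titer θ n ψ = T_n ψ = (D+δ_{n−1})⋯(D+δ₀)ψ`. -/
def Titer {N : ℕ} (θ : ℕ → SF N) : ℕ → SF N → SF N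
  | 0, ψ => ψ
  | m + 1, ψ => (Titer θ m ψ).Dsd + delta0 (darbIter θ m m) * Titer θ m ψ

/-- Determinant of a matrix of superfields: Leibniz formula with rows in
ascending order (for matrices of commuting, e.g. even, entries this is the usual
determinant, and when exactly one row is odd it agrees with the Laplace
expansion along that row). -/
def detSF {N k : ℕ} (M : Matrix (Fin k) (Fin k) (SF N)) : SF N :=
  ∑ σ : Equiv.Perm (Fin k),
    ((Equiv.Perm.sign σ : ℤ)) • (((List.finRange k).map fun i => M i (σ i)).prod)

/-- Entrywise `D`-derivative of a matrix of superfields. -/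
def DmatSF {N m n : ℕ} (M : Matrix (Fin m) (Fin n) (SF N)) : Matrix (Fin m) (Fin n) (SF N) :=
  Matrix.of fun i j => (M i j).Dsd

/-- The embedding `Fin (k−1) → Fin k` skipping `j`. -/
def dropIdx {k : ℕ} (j : Fin k) (i : Fin (k - 1)) : Fin k :=
  ⟨if i.1 < j.1 then i.1 else i.1 + 1, by
    have h1 := i.2; have h2 := j.2; split <;> omega⟩

/-- The minor of `M` obtained by deleting row `j` and column `i`. -/
def minorSF {N k : ℕ} (M : Matrix (Fin k) (Fin k) (SF N)) (j i : Fin k) :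
    Matrix (Fin (k-1)) (Fin (k-1)) (SF N) :=
  M.submatrix (dropIdx j) (dropIdx i)

/-- Adjugate matrix (matrix of cofactors, transposed). -/
def adjSF {N k : ℕ} (M : Matrix (Fin k) (Fin k) (SF N)) : Matrix (Fin k) (Fin k) (SF N) :=
  Matrix.of fun i j => ((-1 : ℤ) ^ (i.1 + j.1)) • detSF (minorSF M j i)

/-- Inverse of a matrix of (even) superfields, via the adjugate
(junk unless `detSF M` is invertible). -/
def invSF {N k : ℕ} (M : Matrix (Fin k) (Fin k) (SF N)) : Matrix (Fin k) (Fin k) (SF N) :=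
  Matrix.of fun i j => (detSF M).sinv * adjSF M i j

section EvenWronskian

variable {N : ℕ}

/-- `θ^{(0)} = (θ₀, θ₂, …)`. -/
def evenSeq (θ : ℕ → SF N) : ℕ → SF N := fun j => θ (2 * j)

/-- `θ^{(1)} = (θ₁, θ₃, …)`. -/
def oddSeq (θ : ℕ → SF N) : ℕ → SF N := fun j => θ (2 * j + 1)

/-- The `k×k` Wronski matrix with rows `v, ∂v, …, ∂^{k−1}v`. -/
def Wmat (N : ℕ) (k : ℕ) (v : ℕ → SF N) : Matrix (Fin k) (Fin k) (SF N) :=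
  Matrix.of fun i j => Xpow i.1 (v j.1)

/-- The Wronski matrix with last row replaced by `∂^k v`. -/
def WmatHat (N : ℕ) (k : ℕ) (v : ℕ → SF N) : Matrix (Fin k) (Fin k) (SF N) :=
  Matrix.of fun i j => if i.1 = k - 1 then Xpow k (v j.1) else Xpow i.1 (v j.1)

/-- The Wronski matrix with rows `Dv, D∂v, …, D∂^{k−2}v` and last row `∂^k v`. -/
def WmatBarD (N : ℕ) (k : ℕ) (v : ℕ → SF N) : Matrix (Fin k) (Fin k) (SF N) :=
  Matrix.of fun i j => if i.1 = k - 1 then Xpow k (v j.1) else (Xpow i.1 (v j.1)).Dsd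

/-- `W^{(0)}` (even case, `n = 2k`). -/
def W0E (N k : ℕ) (θ : ℕ → SF N) : Matrix (Fin k) (Fin k) (SF N) := Wmat N k (evenSeq θ)

/-- `W^{(1)}` (even case, `n = 2k`). -/
def W1E (N k : ℕ) (θ : ℕ → SF N) : Matrix (Fin k) (Fin k) (SF N) := Wmat N k (oddSeq θ)

/-- The Schur complement `W^{(0)} − W^{(1)}(DW^{(1)})⁻¹DW^{(0)}`. -/
def SchurE (N k : ℕ) (θ : ℕ → SF N) : Matrix (Fin k) (Fin k) (SF N) :=
  W0E N k θ - W1E N k θ * invSF (DmatSF (W1E N k θ)) * DmatSF (W0E N k θ)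

/-- The Schur complement `DW^{(1)} − (DW^{(0)})(W^{(0)})⁻¹W^{(1)}`. -/
def SchurE2 (N k : ℕ) (θ : ℕ → SF N) : Matrix (Fin k) (Fin k) (SF N) :=
  DmatSF (W1E N k θ) - DmatSF (W0E N k θ) * invSF (W0E N k θ) * W1E N k θ

/-- `sdet 𝒲` (even case). -/
def sdetE (N k : ℕ) (θ : ℕ → SF N) : SF N :=
  detSF (SchurE N k θ) * (detSF (DmatSF (W1E N k θ))).sinv

/-- The Schur complement of the block matrix `𝒲̂` (even case). -/
def SchurEHat (N k : ℕ) (θ : ℕ → SF N) : Matrix (Fin k) (Fin k) (SF N) :=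
  WmatHat N k (evenSeq θ) - WmatHat N k (oddSeq θ) * invSF (DmatSF (W1E N k θ)) * DmatSF (W0E N k θ)

/-- `sdet 𝒲̂` (even case). -/
def sdetEHat (N k : ℕ) (θ : ℕ → SF N) : SF N :=
  detSF (SchurEHat N k θ) * (detSF (DmatSF (W1E N k θ))).sinv

end EvenWronskian

section OddWronskian

/-- `W^{(0)}`, a `(k+1)×(k+1)` matrix (odd case, `n = 2k+1`). -/
def W0O (N k : ℕ) (θ : ℕ → SF N) : Matrix (Fin (k+1)) (Fin (k+1)) (SF N) :=
  Matrix.of fun i j => Xpow i.1 (θ (2 * j.1))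

/-- `W^{(1)}`, a `(k+1)×k` matrix (odd case). -/
def W1O (N k : ℕ) (θ : ℕ → SF N) : Matrix (Fin (k+1)) (Fin k) (SF N) :=
  Matrix.of fun i j => Xpow i.1 (θ (2 * j.1 + 1))

/-- `W̃^{(0)}`: `W^{(0)}` with its last row removed. -/
def Wtil0 (N k : ℕ) (θ : ℕ → SF N) : Matrix (Fin k) (Fin (k+1)) (SF N) :=
  Matrix.of fun i j => Xpow i.1 (θ (2 * j.1))

/-- `W̃^{(1)}`: `W^{(1)}` with its last row removed. -/
def Wtil1 (N k : ℕ) (θ : ℕ → SF N) : Matrix (Fin k) (Fin k) (SF N) :=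
  Matrix.of fun i j => Xpow i.1 (θ (2 * j.1 + 1))

/-- `W̌^{(0)}`: `W^{(0)}` with its second-to-last row removed. -/
def Wchk0 (N k : ℕ) (θ : ℕ → SF N) : Matrix (Fin k) (Fin (k+1)) (SF N) :=
  Matrix.of fun i j => Xpow (if i.1 = k - 1 then k else i.1) (θ (2 * j.1))

/-- `W̌^{(1)}`: `W^{(1)}` with its second-to-last row removed. -/
def Wchk1 (N k : ℕ) (θ : ℕ → SF N) : Matrix (Fin k) (Fin k) (SF N) :=
  Matrix.of fun i j => Xpow (if i.1 = k - 1 then k else i.1) (θ (2 * j.1 + 1))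

/-- `Ŵ^{(0)}`: `W^{(0)}` with last row `∂^k θ^{(0)}` replaced by `D∂^k θ^{(0)}`. -/
def W0OHat (N k : ℕ) (θ : ℕ → SF N) : Matrix (Fin (k+1)) (Fin (k+1)) (SF N) :=
  Matrix.of fun i j => if i.1 = k then Dpow (2*k+1) (θ (2 * j.1)) else Xpow i.1 (θ (2 * j.1))

/-- `Ŵ^{(1)}`: `W^{(1)}` with last row `∂^k θ^{(1)}` replaced by `D∂^k θ^{(1)}`. -/
def W1OHat (N k : ℕ) (θ : ℕ → SF N) : Matrix (Fin (k+1)) (Fin k) (SF N) :=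
  Matrix.of fun i j => if i.1 = k then Dpow (2*k+1) (θ (2 * j.1 + 1)) else Xpow i.1 (θ (2 * j.1 + 1))

/-- The Schur complement `W^{(0)} − W^{(1)}(DW̃^{(1)})⁻¹DW̃^{(0)}`. -/
def SchurO (N k : ℕ) (θ : ℕ → SF N) : Matrix (Fin (k+1)) (Fin (k+1)) (SF N) :=
  W0O N k θ - W1O N k θ * invSF (DmatSF (Wtil1 N k θ)) * DmatSF (Wtil0 N k θ)

/-- The Schur complement `W^{(0)} − W^{(1)}(DW̌^{(1)})⁻¹DW̌^{(0)}`. -/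
def SchurOchk (N k : ℕ) (θ : ℕ → SF N) : Matrix (Fin (k+1)) (Fin (k+1)) (SF N) :=
  W0O N k θ - W1O N k θ * invSF (DmatSF (Wchk1 N k θ)) * DmatSF (Wchk0 N k θ)

/-- The Schur complement `Ŵ^{(0)} − Ŵ^{(1)}(DW̃^{(1)})⁻¹DW̃^{(0)}`. -/
def SchurOHat (N k : ℕ) (θ : ℕ → SF N) : Matrix (Fin (k+1)) (Fin (k+1)) (SF N) :=
  W0OHat N k θ - W1OHat N k θ * invSF (DmatSF (Wtil1 N k θ)) * DmatSF (Wtil0 N k θ)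

/-- `sdet 𝒲` (odd case). -/
def sdetO (N k : ℕ) (θ : ℕ → SF N) : SF N :=
  detSF (SchurO N k θ) * (detSF (DmatSF (Wtil1 N k θ))).sinv

/-- `sdet 𝒲̌` (odd case). -/
def sdetOchk (N k : ℕ) (θ : ℕ → SF N) : SF N :=
  detSF (SchurOchk N k θ) * (detSF (DmatSF (Wchk1 N k θ))).sinv

/-- The quotient `det(Ŵ^{(0)} − Ŵ^{(1)}(DW̃^{(1)})⁻¹DW̃^{(0)}) / det(W^{(0)} − W^{(1)}(DW̃^{(1)})⁻¹DW̃^{(0)})`. -/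
def Qodd (N k : ℕ) (θ : ℕ → SF N) : SF N :=
  detSF (SchurOHat N k θ) * (detSF (SchurO N k θ)).sinv

end OddWronskian

/-- The abstract computation in a ring with an odd derivation. -/
theorem core_calc {R : Type*} [Ring R] (D : R → R) (σ : R → R)
    (Dadd : ∀ f g, D (f + g) = D f + D g)
    (leib : ∀ f g, D (f * g) = D f * g + σ f * D g)
    (σmul : ∀ f g, σ (f * g) = σ f * σ g)
    (σneg : ∀ f, σ (-f) = - σ f) (σone : σ 1 = 1)
    (σσ : ∀ f, σ (σ f) = f) (Dσ : ∀ f, D (σ f) = - σ (D f))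
    (evc : ∀ a, σ a = a → ∀ b, a * b = b * a)
    (oda : ∀ a b, σ a = -a → σ b = -b → a * b = -(b * a))
    (odsq : ∀ a, σ a = -a → a * a = 0)
    (α u θ θi ψ c c0 δ : R) (hα : σ α = -α) (hu : σ u = u) (hθ : σ θ = θ)
    (hc : σ c = c) (Dc : D c = 0) (Dc0 : D c0 = 0)
    (hi : θ * θi = 1) (hδ : δ = -(D θ * θi))
    (h0 : D (D (D (D θ))) + α * D θ + u * θ = c0 * θ)
    (h1 : D (D (D (D ψ))) + α * D ψ + u * ψ = c * ψ) :
    D (D (D (D (D ψ + δ * ψ)))) + (-α - (D (D δ) + D (D δ))) * D (D ψ + δ * ψ)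
      + (u + D α + (δ * (α + D (D δ)) + δ * (α + D (D δ)))) * (D ψ + δ * ψ)
      = c * (D ψ + δ * ψ) := by
  have D0 : D 0 = 0 := by simpa using Dadd 0 0
  have Dneg : ∀ f, D (-f) = - D f := fun f => by
    have := Dadd f (-f)
    rw [add_neg_cancel, D0] at this
    exact (neg_eq_of_add_eq_zero_right this.symm).symm
  have leib2 : ∀ f g, D (D (f * g)) = D (D f) * g + f * D (D g) := fun f g => by
    rw [leib, Dadd, leib, leib, Dσ, σσ]; noncomm_ring
  have σDe : ∀ f, σ f = f → σ (D f) = - D f := fun f h => by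
    have := Dσ f; rw [h] at this; exact eq_neg_of_add_eq_zero_left (by nth_rewrite 2 [this]; simp)
  have σDo : ∀ f, σ f = -f → σ (D f) = D f := fun f h => by
    have := Dσ f; rw [h, Dneg] at this; exact (neg_injective this).symm
  have hi' : θi * θ = 1 := by rw [← evc θ hθ, hi]
  have σθi : σ θi = θi := by
    have h : θ * σ θi = 1 := by
      have := congrArg σ hi
      rwa [σmul, hθ, σone] at this
    calc σ θi = (θi * θ) * σ θi := by rw [hi', one_mul]
      _ = θi := by rw [mul_assoc, h, mul_one]
  have σδ : σ δ = -δ := by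
    rw [hδ, σneg, σmul, σθi, σDe θ hθ]; noncomm_ring
  have hDθ : D θ = -(δ * θ) := by
    rw [hδ, neg_mul, neg_neg, mul_assoc, hi', mul_one]
  have hDDθ : D (D θ) = -(D δ * θ) := by
    rw [hDθ, Dneg, leib, σδ, hDθ]
    have := odsq δ σδ
    simp [← mul_assoc, this]
  have σe : σ (D δ) = D δ := σDo δ σδ
  have ec := evc _ σe
  have star : -(D (D (D δ))) + D δ * D δ - α * δ + u = c0 := by
    have h : (-(D (D (D δ))) + D δ * D δ - α * δ + u) * θ = c0 * θ := by
      rw [← h0, hDDθ, Dneg, Dneg, leib2, hDDθ, hDθ]; noncomm_ring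
    calc _ = (-(D (D (D δ))) + D δ * D δ - α * δ + u) * θ * θi := by
            rw [mul_assoc, hi, mul_one]
      _ = c0 := by rw [h, mul_assoc, hi, mul_one]
  have star2 : -(D (D (D (D δ)))) + (D (D δ) * D δ + D δ * D (D δ)) - (D α * δ - α * D δ) + D u
      = 0 := by
    have := congrArg D star
    rw [Dc0, Dadd, sub_eq_add_neg, Dadd, Dadd, Dneg, Dneg, leib, leib, σe, hα] at this
    rw [← this]; noncomm_ring
  have h2 := congrArg D h1
  rw [leib c, Dc, hc, Dadd, Dadd, leib, leib, hα, hu] at h2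
  have h3 : δ * (D (D (D (D ψ))) + α * D ψ + u * ψ) = c * (δ * ψ) := by
    rw [h1, ← mul_assoc, ← mul_assoc, evc c hc]
  have σd : σ (D (D δ)) = - D (D δ) := σDe _ σe
  have aδ := oda _ _ hα σδ
  have dδ := oda _ _ σd σδ
  have δδ := odsq δ σδ
  have uδ := evc u hu δ
  have ed := ec (D (D δ))
  have aδ' : ∀ x, α * (δ * x) = -(δ * (α * x)) := fun x => by
    rw [← mul_assoc, aδ, neg_mul, mul_assoc]
  have dδ' : ∀ x, D (D δ) * (δ * x) = -(δ * (D (D δ) * x)) := fun x => by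
    rw [← mul_assoc, dδ, neg_mul, mul_assoc]
  have δδ' : ∀ x, δ * (δ * x) = 0 := fun x => by rw [← mul_assoc, δδ, zero_mul]
  have uδ' : ∀ x, u * (δ * x) = δ * (u * x) := fun x => by
    rw [← mul_assoc, uδ, mul_assoc]
  have ed' : ∀ x, D δ * (D (D δ) * x) = D (D δ) * (D δ * x) := fun x => by
    rw [← mul_assoc, ed, mul_assoc]
  have hDu : D u = D (D (D (D δ))) - (D (D δ) * D δ + D δ * D (D δ)) + (D α * δ - α * D δ) := by
    rw [← sub_eq_zero, ← star2]; abel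
  rw [zero_mul, zero_add] at h2
  rw [mul_add c, ← h2, ← h3, hDu]
  simp only [Dadd, leib2]
  simp only [leib, σδ]
  simp only [mul_add, add_mul, sub_mul, neg_mul, mul_neg, mul_sub, mul_assoc, neg_neg,
    aδ', dδ', δδ', uδ', ed', mul_zero, neg_zero]
  abel

section Helpers
variable {N : ℕ}

abbrev extB (N : ℕ) : Module.Basis (Finset (Fin N)) ℝ (SuperAlg N) :=
  (Pi.basisFun ℝ (Fin N)).ExteriorAlgebra

/-- weak derivative -/
def HD (g : ℝ → SuperAlg N) (d : SuperAlg N) (x : ℝ) : Prop :=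
  ∀ l : SuperAlg N →ₗ[ℝ] ℝ, HasDerivAt (fun y => l (g y)) (l d) x

theorem lin_expand (l : SuperAlg N →ₗ[ℝ] ℝ) (a : SuperAlg N) :
    l a = ∑ s, (extB N).coord s a * l (extB N s) := by
  conv_lhs => rw [← (extB N).sum_repr a]
  rw [map_sum]
  simp only [map_smul, smul_eq_mul, Module.Basis.coord_apply]

theorem eq_of_lin {a b : SuperAlg N} (h : ∀ l : SuperAlg N →ₗ[ℝ] ℝ, l a = l b) : a = b :=
  (extB N).ext_elem fun s => h ((extB N).coord s)

theorem HD.derLam_eq {g : ℝ → SuperAlg N} {d : SuperAlg N} {x : ℝ} (h : HD g d x) :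
    derLam g x = d := by
  have hex : ∃ d : SuperAlg N, ∀ l : SuperAlg N →ₗ[ℝ] ℝ,
      HasDerivAt (fun y => l (g y)) (l d) x := ⟨d, h⟩
  unfold derLam
  rw [dif_pos hex]
  exact eq_of_lin fun l => (hex.choose_spec l).unique (h l)

theorem HD.of_diff {g : ℝ → SuperAlg N} {x : ℝ}
    (h : ∀ l : SuperAlg N →ₗ[ℝ] ℝ, DifferentiableAt ℝ (fun y => l (g y)) x) :
    HD g (derLam g x) x := by
  have key : HD g (∑ s, deriv (fun y => (extB N).coord s (g y)) x • extB N s) x := by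
    intro l
    have h1 : HasDerivAt (fun y => ∑ s, (extB N).coord s (g y) * l (extB N s))
        (∑ s, deriv (fun y => (extB N).coord s (g y)) x * l (extB N s)) x :=
      HasDerivAt.fun_sum fun s _ => (h ((extB N).coord s)).hasDerivAt.mul_const _
    have e : (fun y => l (g y)) = fun y => ∑ s, (extB N).coord s (g y) * l (extB N s) := by
      funext y; exact lin_expand l (g y)
    rw [e]
    simpa [map_sum] using h1
  rw [key.derLam_eq]; exact key

theorem HD.add {f g : ℝ → SuperAlg N} {a b : SuperAlg N} {x : ℝ} (hf : HD f a x)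
    (hg : HD g b x) : HD (fun y => f y + g y) (a + b) x := fun l => by
  have := (hf l).fun_add (hg l)
  simp only [map_add]
  exact this

theorem HD.lin {f : ℝ → SuperAlg N} {a : SuperAlg N} {x : ℝ} (hf : HD f a x)
    (T : SuperAlg N →ₗ[ℝ] SuperAlg N) : HD (fun y => T (f y)) (T a) x := fun l =>
  hf (l ∘ₗ T)

theorem lin_mul_expand (l : SuperAlg N →ₗ[ℝ] ℝ) (a b : SuperAlg N) :
    l (a * b) = ∑ s, ∑ r, (extB N).coord s a * (extB N).coord r b * l (extB N s * extB N r) := by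
  conv_lhs => rw [← (extB N).sum_repr a, ← (extB N).sum_repr b]
  rw [Finset.sum_mul_sum, map_sum]
  refine Finset.sum_congr rfl fun s _ => ?_
  rw [map_sum]
  refine Finset.sum_congr rfl fun r _ => ?_
  rw [smul_mul_smul_comm, map_smul, smul_eq_mul, Module.Basis.coord_apply,
    Module.Basis.coord_apply]

theorem HD.mul {f g : ℝ → SuperAlg N} {a b : SuperAlg N} {x : ℝ} (hf : HD f a x)
    (hg : HD g b x) : HD (fun y => f y * g y) (a * g x + f x * b) x := fun l => by
  have e : (fun y => l (f y * g y)) = fun y => ∑ s, ∑ r, (extB N).coord s (f y) *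
      (extB N).coord r (g y) * l (extB N s * extB N r) := by
    funext y; exact lin_mul_expand l _ _
  rw [e, map_add, lin_mul_expand l a, lin_mul_expand l (f x), ← Finset.sum_add_distrib]
  simp_rw [← Finset.sum_add_distrib, ← add_mul]
  exact HasDerivAt.fun_sum fun s _ => HasDerivAt.fun_sum fun r _ =>
    ((hf ((extB N).coord s)).mul (hg ((extB N).coord r))).mul_const _

theorem HD.const (a : SuperAlg N) (x : ℝ) : HD (fun _ => a) 0 x := fun l => by
  simpa using hasDerivAt_const x (l a)

theorem SmoothLam.hd {g : ℝ → ℝ → SuperAlg N} (h : SmoothLam g) (x t : ℝ) :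
    HD (fun y => g y t) (derLam (fun y => g y t) x) x := by
  apply HD.of_diff
  intro l
  have h1 : ContDiff ℝ (⊤ : ℕ∞) (fun y : ℝ => l (g y t)) :=
    (h l).comp (contDiff_id.prodMk contDiff_const)
  exact (h1.differentiable (by simp)) x

theorem SmoothLam.der {g : ℝ → ℝ → SuperAlg N} (h : SmoothLam g) :
    SmoothLam (fun x t => derLam (fun y => g y t) x) := by
  intro l
  have e : (fun p : ℝ × ℝ => l (derLam (fun y => g y p.2) p.1)) =
      fun p => fderiv ℝ (fun p : ℝ × ℝ => l (g p.1 p.2)) p (1, 0) := by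
    funext p
    have hd : HasFDerivAt (fun p : ℝ × ℝ => l (g p.1 p.2))
      (fderiv ℝ (fun p : ℝ × ℝ => l (g p.1 p.2)) p) p :=
      ((h l).differentiable (by simp) p).hasFDerivAt
    have hc : HasDerivAt (fun y : ℝ => (y, p.2)) ((1 : ℝ), (0 : ℝ)) p.1 :=
      (hasDerivAt_id p.1).prodMk (hasDerivAt_const p.1 p.2)
    exact (h.hd p.1 p.2 l).unique (HasFDerivAt.comp_hasDerivAt (x := p.1)
      (f := fun y : ℝ => (y, p.2)) hd hc)
  rw [e]
  exact ((h l).fderiv_right (m := (⊤ : ℕ∞)) (by simp)).clm_apply contDiff_const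

theorem SmoothLam.add {f g : ℝ → ℝ → SuperAlg N} (hf : SmoothLam f) (hg : SmoothLam g) :
    SmoothLam (fun x t => f x t + g x t) := fun l => by
  simpa using (hf l).add (hg l)

theorem SmoothLam.lin {f : ℝ → ℝ → SuperAlg N} (hf : SmoothLam f)
    (T : SuperAlg N →ₗ[ℝ] SuperAlg N) : SmoothLam (fun x t => T (f x t)) := fun l =>
  hf (l ∘ₗ T)

theorem SmoothLam.neg {f : ℝ → ℝ → SuperAlg N} (hf : SmoothLam f) :
    SmoothLam (fun x t => - f x t) := hf.lin (-LinearMap.id)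

theorem SmoothLam.inv {f : ℝ → ℝ → SuperAlg N} (hf : SmoothLam f) :
    SmoothLam (fun x t => CliffordAlgebra.involute (f x t)) :=
  hf.lin CliffordAlgebra.involute.toLinearMap

theorem SmoothLam.const (a : SuperAlg N) : SmoothLam (fun _ _ => a) := fun _ => contDiff_const

theorem SmoothLam.mul {f g : ℝ → ℝ → SuperAlg N} (hf : SmoothLam f) (hg : SmoothLam g) :
    SmoothLam (fun x t => f x t * g x t) := fun l => by
  have e : (fun p : ℝ × ℝ => l (f p.1 p.2 * g p.1 p.2)) = fun p => ∑ s, ∑ r,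
      (extB N).coord s (f p.1 p.2) *
      (extB N).coord r (g p.1 p.2) * l (extB N s * extB N r) := by
    funext y; exact lin_mul_expand l _ _
  rw [e]
  exact ContDiff.sum fun s _ => ContDiff.sum fun r _ =>
    ((hf ((extB N).coord s)).mul (hg ((extB N).coord r))).mul contDiff_const

theorem contDiff_det {ι : Type*} [Fintype ι] [DecidableEq ι] (M : ℝ × ℝ → Matrix ι ι ℝ)
    (h : ∀ i j, ContDiff ℝ (⊤ : ℕ∞) (fun p => M p i j)) :
    ContDiff ℝ (⊤ : ℕ∞) (fun p => (M p).det) := by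
  simp only [Matrix.det_apply']
  exact ContDiff.sum fun σ _ => contDiff_const.mul (contDiff_prod fun i _ => h _ _)

theorem contDiff_adj {ι : Type*} [Fintype ι] [DecidableEq ι] (M : ℝ × ℝ → Matrix ι ι ℝ)
    (h : ∀ i j, ContDiff ℝ (⊤ : ℕ∞) (fun p => M p i j)) (i j : ι) :
    ContDiff ℝ (⊤ : ℕ∞) (fun p => (M p).adjugate i j) := by
  simp only [Matrix.adjugate_apply]
  apply contDiff_det
  intro a b
  simp only [Matrix.updateRow_apply]
  split_ifs
  · exact contDiff_const
  · exact h a b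

theorem SmoothLam.ringInverse {f : ℝ → ℝ → SuperAlg N} (hf : SmoothLam f)
    (hu : ∀ x t, IsUnit (f x t)) : SmoothLam (fun x t => Ring.inverse (f x t)) := by
  classical
  let M : SuperAlg N → Matrix (Finset (Fin N)) (Finset (Fin N)) ℝ :=
    fun a => Algebra.leftMulMatrix (extB N) a
  have hM : ∀ i j, ContDiff ℝ (⊤ : ℕ∞) (fun p : ℝ × ℝ => M (f p.1 p.2) i j) := by
    intro i j
    have := (hf.mul (SmoothLam.const (extB N j))) ((extB N).coord i)
    simpa [M, Algebra.leftMulMatrix_eq_repr_mul] using this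
  have hdet : ∀ p : ℝ × ℝ, (M (f p.1 p.2)).det ≠ 0 := by
    intro p
    have h1 : IsUnit (M (f p.1 p.2)) := (hu p.1 p.2).map (Algebra.leftMulMatrix (extB N))
    exact ((Matrix.isUnit_iff_isUnit_det _).mp h1).ne_zero
  intro l
  have e : (fun p : ℝ × ℝ => l (Ring.inverse (f p.1 p.2))) = fun p => ∑ s,
      (((M (f p.1 p.2)).det)⁻¹ * ∑ j, (M (f p.1 p.2)).adjugate s j * (extB N).repr 1 j)
        * l (extB N s) := by
    funext p
    rw [lin_expand l]
    refine Finset.sum_congr rfl fun s _ => ?_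
    congr 1
    have h1 : M (f p.1 p.2) * M (Ring.inverse (f p.1 p.2)) = 1 := by
      simp only [M]
      rw [← map_mul, Ring.mul_inverse_cancel _ (hu _ _), map_one]
    have h2 : M (Ring.inverse (f p.1 p.2)) =
        ((M (f p.1 p.2)).det)⁻¹ • (M (f p.1 p.2)).adjugate := by
      rw [← Matrix.inv_eq_right_inv h1, Matrix.inv_def, Ring.inverse_eq_inv']
    have h3 : (extB N).repr (Ring.inverse (f p.1 p.2)) =
        (M (Ring.inverse (f p.1 p.2))).mulVec ((extB N).repr 1) := by
      simp only [M]
      rw [Algebra.leftMulMatrix_mulVec_repr, mul_one]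
    rw [Module.Basis.coord_apply, h3, h2]
    simp [Matrix.mulVec, dotProduct, Finset.mul_sum, mul_assoc]
  rw [e]
  exact ContDiff.sum fun s _ => (((contDiff_det _ hM).inv hdet).mul
    (ContDiff.sum fun j _ => (contDiff_adj _ hM s j).mul contDiff_const)).mul contDiff_const

end Helpers

section Helpers2
variable {N : ℕ}

theorem ext_comm_even {a : SuperAlg N} (ha : a ∈ LambdaEven N) (b : SuperAlg N) :
    a * b = b * a := by
  have key : ∀ i : ZMod 2, ∀ c ∈ CliffordAlgebra.evenOdd (0 : QuadraticForm ℝ (Fin N → ℝ)) i,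
      a * c = c * a := by
    intro i c hc
    have := CliffordAlgebra.commute_map_mul_map_of_isOrtho_of_mem_evenOdd_zero_left
      (QuadraticMap.Isometry.id (0 : QuadraticForm ℝ (Fin N → ℝ)))
      (QuadraticMap.Isometry.id (0 : QuadraticForm ℝ (Fin N → ℝ)))
      (fun x y => by simp [QuadraticMap.IsOrtho]) a c ha hc
    simpa using this.eq
  obtain ⟨b0, h0, b1, h1, rfl⟩ := Submodule.mem_sup.mp
    ((CliffordAlgebra.evenOdd_isCompl (0 : QuadraticForm ℝ (Fin N → ℝ))).sup_eq_top ▸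
      Submodule.mem_top : b ∈ _ ⊔ _)
  rw [mul_add, add_mul, key 0 b0 h0, key 1 b1 h1]

theorem ext_anti_odd {a c : SuperAlg N} (ha : a ∈ LambdaOdd N) (hc : c ∈ LambdaOdd N) :
    a * c = -(c * a) := by
  have := CliffordAlgebra.map_mul_map_eq_neg_of_isOrtho_of_mem_evenOdd_one
      (QuadraticMap.Isometry.id (0 : QuadraticForm ℝ (Fin N → ℝ)))
      (QuadraticMap.Isometry.id (0 : QuadraticForm ℝ (Fin N → ℝ)))
      (fun x y => by simp [QuadraticMap.IsOrtho]) a c ha hc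
  simpa using this

theorem inv_even {a : SuperAlg N} (ha : a ∈ LambdaEven N) : CliffordAlgebra.involute a = a :=
  CliffordAlgebra.involute_eq_of_mem_even ha

theorem inv_odd {a : SuperAlg N} (ha : a ∈ LambdaOdd N) : CliffordAlgebra.involute a = -a :=
  CliffordAlgebra.involute_eq_of_mem_odd ha

theorem ext_decomp (b : SuperAlg N) : ∃ b0 ∈ LambdaEven N, ∃ b1 ∈ LambdaOdd N, b0 + b1 = b :=
  Submodule.mem_sup.mp
    ((CliffordAlgebra.evenOdd_isCompl (0 : QuadraticForm ℝ (Fin N → ℝ))).sup_eq_top ▸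
      Submodule.mem_top : b ∈ LambdaEven N ⊔ LambdaOdd N)

theorem ext_comm_odd {a : SuperAlg N} (ha : a ∈ LambdaOdd N) (b : SuperAlg N) :
    a * b = CliffordAlgebra.involute b * a := by
  obtain ⟨b0, h0, b1, h1, rfl⟩ := ext_decomp b
  rw [map_add, inv_even h0, inv_odd h1, mul_add, add_mul, ext_anti_odd ha h1,
    ext_comm_even h0 a, neg_mul]

theorem even_of_inv {a : SuperAlg N} (h : CliffordAlgebra.involute a = a) :
    a ∈ LambdaEven N := by
  obtain ⟨b0, h0, b1, h1, rfl⟩ := ext_decomp a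
  rw [map_add, inv_even h0, inv_odd h1] at h
  have h2 : (2 : ℝ) • b1 = 0 := by
    have := add_left_cancel h
    rw [two_smul]; nth_rewrite 1 [← this]; simp
  have h3 : b1 = 0 := by simpa using h2
  simpa [h3] using h0

theorem odd_of_inv {a : SuperAlg N} (h : CliffordAlgebra.involute a = -a) :
    a ∈ LambdaOdd N := by
  obtain ⟨b0, h0, b1, h1, rfl⟩ := ext_decomp a
  rw [map_add, inv_even h0, inv_odd h1, neg_add] at h
  have h2 : (2 : ℝ) • b0 = 0 := by
    have := add_right_cancel h
    rw [two_smul]; nth_rewrite 1 [this]; simp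
  have h3 : b0 = 0 := by simpa using h2
  simpa [h3] using h1

namespace SF

@[simp] theorem add_c0 (f g : SF N) (x t : ℝ) : (f + g).c0 x t = f.c0 x t + g.c0 x t := rfl
@[simp] theorem add_c1 (f g : SF N) (x t : ℝ) : (f + g).c1 x t = f.c1 x t + g.c1 x t := rfl
@[simp] theorem neg_c0 (f : SF N) (x t : ℝ) : (-f).c0 x t = -f.c0 x t := rfl
@[simp] theorem neg_c1 (f : SF N) (x t : ℝ) : (-f).c1 x t = -f.c1 x t := rfl
@[simp] theorem zero_c0 (x t : ℝ) : (0 : SF N).c0 x t = 0 := rfl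
@[simp] theorem zero_c1 (x t : ℝ) : (0 : SF N).c1 x t = 0 := rfl
@[simp] theorem one_c0 (x t : ℝ) : (1 : SF N).c0 x t = 1 := rfl
@[simp] theorem one_c1 (x t : ℝ) : (1 : SF N).c1 x t = 0 := rfl
@[simp] theorem smul_c0 (r : ℝ) (f : SF N) (x t : ℝ) : (r • f).c0 x t = r • f.c0 x t := rfl
@[simp] theorem smul_c1 (r : ℝ) (f : SF N) (x t : ℝ) : (r • f).c1 x t = r • f.c1 x t := rfl
@[simp] theorem mul_c0 (f g : SF N) (x t : ℝ) : (f * g).c0 x t = f.c0 x t * g.c0 x t := rfl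
@[simp] theorem mul_c1 (f g : SF N) (x t : ℝ) : (f * g).c1 x t =
  f.c1 x t * g.c0 x t + CliffordAlgebra.involute (f.c0 x t) * g.c1 x t := rfl

theorem ext' {f g : SF N} (h0 : ∀ x t, f.c0 x t = g.c0 x t) (h1 : ∀ x t, f.c1 x t = g.c1 x t) :
    f = g := SF.ext (funext fun x => funext fun t => h0 x t) (funext fun x => funext fun t => h1 x t)

/-- the ring structure -/
abbrev sfRing (N : ℕ) : Ring (SF N) :=
  { (inferInstance : AddCommGroup (SF N)), (inferInstance : Mul (SF N)),
    (inferInstance : One (SF N)) with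
    left_distrib := fun a b c => ext' (by intros; simp [mul_add])
      (by intros; simp [mul_add]; abel)
    right_distrib := fun a b c => ext' (by intros; simp [add_mul])
      (by intros; simp [add_mul]; abel)
    zero_mul := fun a => ext' (by intros; simp) (by intros; simp)
    mul_zero := fun a => ext' (by intros; simp) (by intros; simp)
    mul_assoc := fun a b c => ext' (by intros; simp [mul_assoc])
      (by intros; simp [mul_add, add_mul, mul_assoc]; abel)
    one_mul := fun a => ext' (by intros; simp) (by intros; simp)
    mul_one := fun a => ext' (by intros; simp) (by intros; simp) }

attribute [local instance] sfRing

/-- grade involution -/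
def gi (f : SF N) : SF N :=
  ⟨fun x t => CliffordAlgebra.involute (f.c0 x t), fun x t => -CliffordAlgebra.involute (f.c1 x t)⟩

@[simp] theorem gi_c0 (f : SF N) (x t : ℝ) :
  (gi f).c0 x t = CliffordAlgebra.involute (f.c0 x t) := rfl
@[simp] theorem gi_c1 (f : SF N) (x t : ℝ) :
  (gi f).c1 x t = -CliffordAlgebra.involute (f.c1 x t) := rfl

theorem Smooth.gi {f : SF N} (h : f.Smooth) : (gi f).Smooth := ⟨h.1.inv, h.2.inv.neg⟩
theorem Smooth.D {f : SF N} (h : f.Smooth) : f.Dsd.Smooth := ⟨h.2, h.1.der⟩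
theorem Smooth.add {f g : SF N} (h : f.Smooth) (h' : g.Smooth) : (f + g).Smooth :=
  ⟨h.1.add h'.1, h.2.add h'.2⟩
theorem Smooth.neg {f : SF N} (h : f.Smooth) : (-f).Smooth := ⟨h.1.neg, h.2.neg⟩
theorem Smooth.mul {f g : SF N} (h : f.Smooth) (h' : g.Smooth) : (f * g).Smooth :=
  ⟨h.1.mul h'.1, (h.2.mul h'.1).add (h.1.inv.mul h'.2)⟩
theorem smooth_one : (1 : SF N).Smooth := ⟨SmoothLam.const 1, SmoothLam.const 0⟩
theorem smooth_zero : (0 : SF N).Smooth := ⟨SmoothLam.const 0, SmoothLam.const 0⟩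

/-- the ring of smooth superfields -/
def smoothRing (N : ℕ) : Subring (SF N) where
  carrier := {f | f.Smooth}
  mul_mem' := Smooth.mul
  one_mem' := smooth_one
  add_mem' := Smooth.add
  zero_mem' := smooth_zero
  neg_mem' := Smooth.neg

theorem even_gi {f : SF N} (h : f.IsEven) : gi f = f :=
  ext' (fun x t => by simp [inv_even (h.1 x t)]) (fun x t => by simp [inv_odd (h.2 x t)])
theorem odd_gi {f : SF N} (h : f.IsOdd) : gi f = -f :=
  ext' (fun x t => by simp [inv_odd (h.1 x t)]) (fun x t => by simp [inv_even (h.2 x t)])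
theorem gi_even {f : SF N} (h : gi f = f) : f.IsEven :=
  ⟨fun x t => even_of_inv (congrArg (fun g : SF N => g.c0 x t) h),
   fun x t => odd_of_inv (neg_eq_iff_eq_neg.mp (congrArg (fun g : SF N => g.c1 x t) h))⟩
theorem gi_odd {f : SF N} (h : gi f = -f) : f.IsOdd :=
  ⟨fun x t => odd_of_inv (congrArg (fun g : SF N => g.c0 x t) h),
   fun x t => even_of_inv (neg_injective (congrArg (fun g : SF N => g.c1 x t) h))⟩

theorem gi_mul (f g : SF N) : gi (f * g) = gi f * gi g :=
  ext' (by intros; simp) (by intros; simp; abel)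

theorem Dsd_add {f g : SF N} (hf : f.Smooth) (hg : g.Smooth) :
    (f + g).Dsd = f.Dsd + g.Dsd :=
  ext' (fun _ _ => rfl) fun x t => ((hf.1.hd x t).add (hg.1.hd x t)).derLam_eq

theorem Dsd_mul {f g : SF N} (hf : f.Smooth) (hg : g.Smooth) :
    (f * g).Dsd = f.Dsd * g + gi f * g.Dsd :=
  ext' (fun _ _ => rfl) fun x t => by
    refine ((hf.1.hd x t).mul (hg.1.hd x t)).derLam_eq.trans ?_
    simp [Dsd]

theorem Dsd_gi {f : SF N} (hf : f.Smooth) : (gi f).Dsd = - gi f.Dsd :=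
  ext' (fun _ _ => rfl) fun x t =>
    ((hf.1.hd x t).lin CliffordAlgebra.involute.toLinearMap).derLam_eq.trans (by simp [Dsd])

theorem even_comm {f : SF N} (h : f.IsEven) (g : SF N) : f * g = g * f :=
  ext' (fun x t => ext_comm_even (h.1 x t) _) fun x t => by
    rw [mul_c1, mul_c1, inv_even (h.1 x t), ext_comm_odd (h.2 x t), ext_comm_even (h.1 x t),
      add_comm]

theorem odd_anti {f g : SF N} (h : f.IsOdd) (h' : g.IsOdd) : f * g = -(g * f) :=
  ext' (fun x t => ext_anti_odd (h.1 x t) (h'.1 x t)) fun x t => by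
    rw [neg_c1, mul_c1, mul_c1, inv_odd (h.1 x t), inv_odd (h'.1 x t), ext_comm_even (h.2 x t),
      ext_comm_even (h'.2 x t)]
    simp

theorem odd_sq {f : SF N} (h : f.IsOdd) : f * f = 0 :=
  ext' (fun x t => by
    have h1 := ext_anti_odd (h.1 x t) (h.1 x t)
    have h2 : (2 : ℝ) • (f.c0 x t * f.c0 x t) = 0 := by
      rw [two_smul]; nth_rewrite 1 [h1]; simp
    simpa using h2) fun x t => by
    rw [mul_c1, inv_odd (h.1 x t), ext_comm_even (h.2 x t)]
    simp

theorem mul_sinv {f : SF N} (h : f.Invertible) : f * f.sinv = 1 :=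
  ext' (fun x t => Ring.mul_inverse_cancel _ (h x t)) fun x t => by
    have h1 : IsUnit (CliffordAlgebra.involute (f.c0 x t)) := (h x t).map _
    have h2 : f.sinv.c1 x t = -(Ring.inverse (CliffordAlgebra.involute (f.c0 x t)) * f.c1 x t *
      Ring.inverse (f.c0 x t)) := rfl
    have h3 : f.sinv.c0 x t = Ring.inverse (f.c0 x t) := rfl
    rw [mul_c1, h2, h3, mul_neg, ← mul_assoc, ← mul_assoc, Ring.mul_inverse_cancel _ h1]
    simp

theorem Smooth.sinv {f : SF N} (hf : f.Smooth) (h : f.Invertible) : f.sinv.Smooth :=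
  ⟨hf.1.ringInverse h,
   (((hf.1.inv.ringInverse fun x t => (h x t).map _).mul hf.2).mul (hf.1.ringInverse h)).neg⟩

/-- constant superfield -/
def cst (N : ℕ) (r : ℝ) : SF N := ⟨fun _ _ => algebraMap ℝ _ r, fun _ _ => 0⟩

theorem cst_mul (r : ℝ) (f : SF N) : cst N r * f = r • f :=
  ext' (by intros; simp [cst, Algebra.smul_def]) (by intros; simp [cst, Algebra.smul_def])

theorem two_smul' (f : SF N) : (2 : ℝ) • f = f + f :=
  ext' (by intros; simp [two_smul]) (by intros; simp [two_smul])

theorem Dsd_cst (r : ℝ) : (cst N r).Dsd = 0 :=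
  ext' (fun _ _ => rfl) fun x _ => (HD.const _ x).derLam_eq

theorem gi_cst (r : ℝ) : gi (cst N r) = cst N r :=
  ext' (by intros; simp [cst]) (by intros; simp [cst])

theorem smooth_cst (r : ℝ) : (cst N r).Smooth := ⟨SmoothLam.const _, SmoothLam.const 0⟩

theorem main_aux (α u : SF N)
    (hαo : α.IsOdd) (hue : u.IsEven) (hαs : α.Smooth) (hus : u.Smooth)
    (lam₀ lam : ℝ) (θ₀ : SF N) (hθe : θ₀.IsEven) (hθi : θ₀.Invertible) (hθs : θ₀.Smooth)
    (hθ : Lop α u θ₀ = lam₀ • θ₀)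
    (ψ : SF N) (hψs : ψ.Smooth) (hψ : Lop α u ψ = lam • ψ) :
    Lop (hatAlpha α θ₀) (hatU α u θ₀) (ψ.Dsd + delta0 θ₀ * ψ)
      = lam • (ψ.Dsd + delta0 θ₀ * ψ) := by
  have hδs : (delta0 θ₀).Smooth := (hθs.D.mul (hθs.sinv hθi)).neg
  have key := core_calc (R := smoothRing N) (fun f => ⟨f.1.Dsd, Smooth.D f.2⟩)
    (fun f => ⟨gi f.1, Smooth.gi f.2⟩)
    (fun f g => Subtype.ext (Dsd_add f.2 g.2))
    (fun f g => Subtype.ext (Dsd_mul f.2 g.2))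
    (fun f g => Subtype.ext (gi_mul _ _))
    (fun f => Subtype.ext (ext' (by intros; simp) (by intros; simp)))
    (Subtype.ext (ext' (by intros; simp) (by intros; simp)))
    (fun f => Subtype.ext (ext' (by intros; simp) (by intros; simp)))
    (fun f => Subtype.ext (Dsd_gi f.2))
    (fun a h b => Subtype.ext (even_comm (gi_even (congrArg Subtype.val h)) _))
    (fun a b h h' => Subtype.ext
      (odd_anti (gi_odd (congrArg Subtype.val h)) (gi_odd (congrArg Subtype.val h'))))
    (fun a h => Subtype.ext (odd_sq (gi_odd (congrArg Subtype.val h))))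
    ⟨α, hαs⟩ ⟨u, hus⟩ ⟨θ₀, hθs⟩ ⟨θ₀.sinv, hθs.sinv hθi⟩ ⟨ψ, hψs⟩
    ⟨cst N lam, smooth_cst _⟩ ⟨cst N lam₀, smooth_cst _⟩ ⟨delta0 θ₀, hδs⟩
    (Subtype.ext (odd_gi hαo)) (Subtype.ext (even_gi hue)) (Subtype.ext (even_gi hθe))
    (Subtype.ext (gi_cst _)) (Subtype.ext (Dsd_cst _)) (Subtype.ext (Dsd_cst _))
    (Subtype.ext (mul_sinv hθi)) (Subtype.ext rfl)
    (Subtype.ext (hθ.trans (cst_mul _ _).symm))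
    (Subtype.ext (hψ.trans (cst_mul _ _).symm))
  have key2 := congrArg Subtype.val key
  rw [← cst_mul, hatAlpha, hatU, two_smul', two_smul']
  exact key2

end SF
end Helpers2


/-- the Darboux transform `ψ̂ = Dψ + δ₀ψ` satisfies `L̂ψ̂ = λψ̂`. -/
theorem statement_1 {N : ℕ} (hN : 1 ≤ N) (α u : SF N)
    (hαo : α.IsOdd) (hue : u.IsEven) (hαs : α.Smooth) (hus : u.Smooth)
    (lam₀ lam : ℝ) (θ₀ : SF N) (hθe : θ₀.IsEven) (hθi : θ₀.Invertible) (hθs : θ₀.Smooth)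
    (hθ : Lop α u θ₀ = lam₀ • θ₀)
    (ψ : SF N) (hψs : ψ.Smooth) (hψ : Lop α u ψ = lam • ψ) :
    Lop (hatAlpha α θ₀) (hatU α u θ₀) (ψ.Dsd + delta0 θ₀ * ψ)
      = lam • (ψ.Dsd + delta0 θ₀ * ψ) := by
  exact SF.main_aux α u hαo hue hαs hus lam₀ lam θ₀ hθe hθi hθs hθ ψ hψs hψ
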